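/- Let X be a nonempty compact metric space and T : X → X a continuous map. Define the ergodic attractor E := ⋃ { supp μ : μ a T-invariant Borel probability measure on X }. Let U be an open subset of X containing E. Then for every u ∈ X, lim_{n→∞} (1/n) ∑_{k=0}^{n-1} 1_U(T^k u) = 1. -/

import Mathlib

open MeasureTheory Filter

/-- The support of a Borel measure: the set of points all of whose open
neighbourhoods have positive measure. -/
def measSupport {X : Type*} [TopologicalSpace X] [MeasurableSpace X]
    (μ : Measure X) : Set X :=
  {x | ∀ U : Set X, IsOpen U → x ∈ U → 0 < μ U}

/-- The uniform probability measure on the first `n + 1` points of the orbit of `x` under `f`. -/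
noncomputable def empiricalMeasure {X : Type*} [MeasurableSpace X] (f : X → X) (x : X) (n : ℕ) :
    ProbabilityMeasure X :=
  ⟨((n + 1 : ℕ) : ENNReal)⁻¹ • ∑ k ∈ Finset.range (n + 1), Measure.dirac (f^[k] x), ⟨by
    simp only [Measure.smul_apply, Measure.finsetSum_apply, measure_univ,
      Finset.sum_const, Finset.card_range, smul_eq_mul, nsmul_eq_mul, mul_one]
    exact ENNReal.inv_mul_cancel (by simp) (ENNReal.natCast_ne_top _)⟩⟩

theorem integral_empiricalMeasure {X : Type*} [MeasurableSpace X] [MeasurableSingletonClass X]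
    (f : X → X) (x : X) (n : ℕ) (g : X → ℝ) :
    ∫ y, g y ∂(empiricalMeasure f x n : Measure X) = birkhoffAverage ℝ f g (n + 1) x := by
  rw [empiricalMeasure, ProbabilityMeasure.coe_mk, integral_smul_measure,
    integral_finsetSum_measure fun _ _ ↦ integrable_dirac (by simp), ENNReal.toReal_inv,
    ENNReal.toReal_natCast]
  simp [birkhoffAverage, birkhoffSum]

theorem measurePreserving_of_tendsto_empiricalMeasure {X : Type*} [TopologicalSpace X]
    [T1Space X] [HasOuterApproxClosed X] [MeasurableSpace X] [BorelSpace X] {f : X → X}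
    (hf : Continuous f) {x : X} {l : Filter ℕ} [l.NeBot] (hl : l ≤ atTop)
    {μ : ProbabilityMeasure X}
    (h : Tendsto (empiricalMeasure f x) l (nhds μ)) :
    MeasurePreserving f μ μ := by
  refine ⟨hf.measurable, ?_⟩
  have := Measure.isProbabilityMeasure_map (μ := (μ : Measure X)) hf.aemeasurable
  refine ext_of_forall_integral_eq_of_IsFiniteMeasure fun g ↦ ?_
  rw [integral_map hf.aemeasurable g.continuous.aestronglyMeasurable]
  rw [ProbabilityMeasure.tendsto_iff_forall_integral_tendsto] at h
  have h₁ := h (g.compContinuous ⟨f, hf⟩)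
  have h₂ := h g
  simp only [integral_empiricalMeasure] at h₁ h₂
  have h₃ := ((tendsto_birkhoffAverage_apply_sub_birkhoffAverage' ℝ g.isBounded_range f x).comp
    (tendsto_add_atTop_nat 1)).mono_left hl
  refine sub_eq_zero.mp (tendsto_nhds_unique ((h₁.sub h₂).congr fun n ↦ ?_) h₃)
  simp [birkhoffAverage, birkhoffSum, (Function.Commute.iterate_self f _).eq x]

theorem stmt_12 {X : Type*} [MetricSpace X] [CompactSpace X] [Nonempty X]
    [MeasurableSpace X] [BorelSpace X]
    (T : X → X) (hT : Continuous T)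
    (U : Set X) (hU : IsOpen U)
    (hEU : {x : X | ∃ μ : Measure X, IsProbabilityMeasure μ ∧
      (∀ A : Set X, MeasurableSet A → μ (T ⁻¹' A) = μ A) ∧ x ∈ measSupport μ} ⊆ U) :
    ∀ u : X, Tendsto (fun n : ℕ =>
      (1 / (n : ℝ)) * ∑ k ∈ Finset.range n,
        Set.indicator U (fun _ => (1 : ℝ)) (T^[k] u)) atTop (nhds 1) := by
  intro u
  rw [← tendsto_add_atTop_iff_nat 1, tendsto_iff_ultrafilter]
  intro g hg
  obtain ⟨μ, -, hμ : Tendsto (empiricalMeasure T u) g (nhds μ)⟩ :=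
    isCompact_univ.ultrafilter_le_nhds (g.map (empiricalMeasure T u)) (by simp)
  have hinv := measurePreserving_of_tendsto_empiricalMeasure hT hg hμ
  have hsupp : (μ : Measure X).support ⊆ U := fun x hx ↦
    hEU ⟨μ, inferInstance, fun A hA ↦ hinv.measure_preimage hA.nullMeasurableSet,
      fun V hV hxV ↦ (Measure.mem_support_iff_forall x).1 hx V (hV.mem_nhds hxV)⟩
  have hμU : (μ : Measure X) U = 1 :=
    (prob_compl_eq_zero_iff hU.measurableSet).1
      (measure_mono_null (Set.compl_subset_compl.2 hsupp) Measure.measure_compl_support)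
  have hlim : Tendsto (fun n ↦ (empiricalMeasure T u n : Measure X) U) g (nhds 1) :=
    tendsto_of_le_liminf_of_limsup_le
      (hμU ▸ ProbabilityMeasure.le_liminf_measure_open_of_tendsto hμ hU)
      (limsup_le_of_le (h := .of_forall fun _ ↦ prob_le_one))
  refine ((ENNReal.tendsto_toReal ENNReal.one_ne_top).comp hlim).congr fun n ↦ ?_
  have hint := integral_empiricalMeasure T u n (U.indicator fun _ ↦ (1 : ℝ))
  rw [integral_indicator_const _ hU.measurableSet] at hint
  simpa [Measure.real, birkhoffAverage, birkhoffSum] using hint
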